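/- Let n ≥ 3. On the SU(2)-Yang–Mills phase manifold of dimension 4n + 3n(n−1)/2, the (n−1)-forms ψ_a = −d(*F_a) − (1/4) γ^c_{ab} A^b ∧ *F_c satisfy, for each a ∈ {1,2,3}, the identity dψ_a = −(1/4) γ^c_{ab} A^b ∧ ψ_c − (1/4) γ^c_{ab} θ^b ∧ *F_c, where θ^a = dA^a − F^a + (1/8) γ^a_{bc} A^b ∧ A^c. -/

import Mathlib

open scoped BigOperators

noncomputable section

namespace EDS

/-- Points of the model space `ℝ^ι` with coordinates indexed by `ι`. -/
abbrev Pt (ι : Type) : Type := ι → ℝ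

/-- A differential `p`-form on `ℝ^ι`, represented by its (antisymmetric)
coefficient functions: `ω idx` is the coefficient `ω_{idx 0 … idx (p-1)}`. -/
abbrev PForm (ι : Type) (p : ℕ) : Type := (Fin p → ι) → Pt ι → ℝ

variable {ι : Type} [Fintype ι] [DecidableEq ι]

/-- A `0`-form from a function. -/
def ofFun (f : Pt ι → ℝ) : PForm ι 0 := fun _ => f

/-- Partial derivative in the coordinate direction `u`. -/
def pd (u : ι) (f : Pt ι → ℝ) : Pt ι → ℝ :=
  fun x => fderiv ℝ f x (Pi.single u 1)

/-- Exterior derivative, in coefficient form: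
`(dω)_{i₀…i_p} = Σ_k (-1)^k ∂_{i_k} ω_{i₀…î_k…i_p}`. -/
def extd {p : ℕ} (ω : PForm ι p) : PForm ι (p + 1) :=
  fun idx x => ∑ k : Fin (p + 1), (-1 : ℝ) ^ (k : ℕ) * pd (idx k) (ω (idx ∘ k.succAbove)) x

/-- Wedge product, in coefficient form:
`(ω∧η)_{i₁…i_{p+q}} = (1/(p!q!)) Σ_{σ ∈ S_{p+q}} sgn σ · ω_{i_{σ(1)}…i_{σ(p)}} η_{i_{σ(p+1)}…i_{σ(p+q)}}`. -/
def wedge {p q : ℕ} (ω : PForm ι p) (η : PForm ι q) : PForm ι (p + q) :=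
  fun idx x => ((p.factorial * q.factorial : ℕ) : ℝ)⁻¹ *
    ∑ σ : Equiv.Perm (Fin (p + q)), ((Equiv.Perm.sign σ : ℤ) : ℝ) *
      (ω (fun i => idx (σ (Fin.castAdd q i))) x * η (fun j => idx (σ (Fin.natAdd p j))) x)

infixl:72 " ⋏ " => wedge

/-- Wedge product of a family of `1`-forms. -/
def wedgeFam {m : ℕ} (α : Fin m → PForm ι 1) : PForm ι m :=
  fun idx x => ∑ σ : Equiv.Perm (Fin m), ((Equiv.Perm.sign σ : ℤ) : ℝ) *
    ∏ t, α t (fun _ => idx (σ t)) x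

/-- Multiplication of a `p`-form by a scalar function. -/
def fsmul (f : Pt ι → ℝ) {p : ℕ} (ω : PForm ι p) : PForm ι p := fun idx x => f x * ω idx x

/-- Reinterpret a `p`-form as a `q`-form along a proof `p = q`. -/
def PForm.cast {p q : ℕ} (h : p = q) (ω : PForm ι p) : PForm ι q :=
  fun idx x => ω (fun i => idx (Fin.cast h i)) x

/-- The totally antisymmetric Levi-Civita symbol `ε`, with `ε(id) = 1`. -/
def eps {m : ℕ} (f : Fin m → Fin m) : ℝ :=
  if h : Function.Bijective f then ((Equiv.Perm.sign (Equiv.ofBijective f h) : ℤ) : ℝ) else 0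

/-- The Lorentz (Minkowski) metric `η = diag(-1,1,…,1)` (diagonal entries). -/
def etaD {m : ℕ} (i : Fin m) : ℝ := if (i : ℕ) = 0 then -1 else 1

/-- Assemble the index tuple `(i, j, k₁, …, k_{n-2})` as a map `Fin n → Fin n`. -/
def raiseIdx {n : ℕ} (i j : Fin n) (k : Fin (n - 2) → Fin n) : Fin n → Fin n :=
  fun t => if h0 : (t : ℕ) = 0 then i else if h1 : (t : ℕ) = 1 then j
    else k ⟨(t : ℕ) - 2, by have := t.isLt; omega⟩

/-! ### The SU(2)-Yang--Mills phase manifold in `n` spacetime dimensions -/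

/-- Index type for the coordinates `A^a_i`, `F^a_{ij}` (`i < j`), `x^i` of the
SU(2)-Yang--Mills phase manifold of dimension `4n + 3n(n-1)/2`. -/
abbrev YC (n : ℕ) : Type :=
  (Fin 3 × Fin n) ⊕ ((Fin 3 × {p : Fin n × Fin n // p.1 < p.2}) ⊕ Fin n)

/-- The totally antisymmetric SU(2) structure constants `γ^a_{bc} = ε_{abc}`:
`gam a b c` is `γ^a_{bc}`, with `γ^1_{23} = 1`. -/
def gam (a b c : Fin 3) : ℝ := eps ![a, b, c]

/-- The coordinate function `x^i`. -/
def xc (n : ℕ) (i : Fin n) : Pt (YC n) → ℝ := fun m => m (Sum.inr (Sum.inr i))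

/-- The coordinate function `A^a_i`. -/
def Ac (n : ℕ) (a : Fin 3) (i : Fin n) : Pt (YC n) → ℝ := fun m => m (Sum.inl (a, i))

/-- The antisymmetric arrays `F^a_{ij} = -F^a_{ji}` built from the coordinates
`F^a_{ij}`, `i < j`. -/
def Fc (n : ℕ) (a : Fin 3) (i j : Fin n) : Pt (YC n) → ℝ := fun m =>
  if h : i < j then m (Sum.inr (Sum.inl (a, ⟨(i, j), h⟩)))
  else if h' : j < i then - m (Sum.inr (Sum.inl (a, ⟨(j, i), h'⟩))) else 0

/-- The coordinate `1`-forms `dx^i`. -/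
def dx (n : ℕ) (i : Fin n) : PForm (YC n) 1 := extd (ofFun (xc n i))

/-- The potential `1`-forms `A^a = A^a_i dx^i`. -/
def Aform (n : ℕ) (a : Fin 3) : PForm (YC n) 1 := ∑ i, fsmul (Ac n a i) (dx n i)

/-- The field `2`-forms `F^a = (1/2) F^a_{ij} dx^i ∧ dx^j`. -/
def Fform (n : ℕ) (a : Fin 3) : PForm (YC n) 2 :=
  (1/2 : ℝ) • ∑ i, ∑ j, fsmul (Fc n a i j) (dx n i ⋏ dx n j)

/-- The dual field `(n-2)`-forms
`*F_a = (1/(2(n-2)!)) F^{a ij} ε_{ij}{}^{k₁…k_{n-2}} dx^{k₁} ∧ ⋯ ∧ dx^{k_{n-2}}`,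
indices raised with the Lorentz metric `η = diag(-1,1,…,1)`. -/
def starF (n : ℕ) (a : Fin 3) : PForm (YC n) (n - 2) :=
  ((2 * (n - 2).factorial : ℕ) : ℝ)⁻¹ • ∑ i, ∑ j, ∑ k : Fin (n - 2) → Fin n,
    (etaD i * etaD j * (∏ t, etaD (k t)) * eps (raiseIdx i j k)) •
      fsmul (Fc n a i j) (wedgeFam (fun t => dx n (k t)))

/-- The `2`-forms `θ^a = dA^a - F^a + (1/8) γ^a_{bc} A^b ∧ A^c`. -/
def theta (n : ℕ) (a : Fin 3) : PForm (YC n) 2 :=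
  extd (Aform n a) - Fform n a +
    (1/8 : ℝ) • ∑ b, ∑ c, gam a b c • (Aform n b ⋏ Aform n c)

/-- The `(n-1)`-forms `ψ_a = -d(*F_a) - (1/4) γ^c_{ab} A^b ∧ *F_c`. -/
def psi (n : ℕ) (a : Fin 3) : PForm (YC n) (n - 2 + 1) :=
  -(extd (starF n a)) -
    PForm.cast (show 1 + (n - 2) = n - 2 + 1 by omega)
      ((1/4 : ℝ) • ∑ b, ∑ c, gam c a b • (Aform n b ⋏ starF n c))

end EDS

namespace EDS
def Alt {ι : Type} {p : ℕ} (T : PForm ι p) : PForm ι p := fun idx x =>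
  ∑ σ : Equiv.Perm (Fin p), ((Equiv.Perm.sign σ : ℤ) : ℝ) * T (fun i => idx (σ i)) x

def tens {ι : Type} {p q : ℕ} (S : PForm ι p) (T : PForm ι q) : PForm ι (p + q) := fun idx x =>
  S (fun i => idx (Fin.castAdd q i)) x * T (fun j => idx (Fin.natAdd p j)) x

def Dt {ι : Type} [Fintype ι] [DecidableEq ι] {p : ℕ} (S : PForm ι p) : PForm ι (p + 1) := fun idx x =>
  pd (idx 0) (S (fun i => idx i.succ)) x

lemma Alt_comp {p : ℕ} {ι : Type} (T : PForm ι p) (τ : Equiv.Perm (Fin p)) (idx : Fin p → ι) (x : Pt ι) :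
    ∑ σ : Equiv.Perm (Fin p), ((Equiv.Perm.sign σ : ℤ) : ℝ) * T (fun i => idx (σ (τ i))) x
      = ((Equiv.Perm.sign τ : ℤ) : ℝ) * Alt T idx x := by
  unfold Alt
  rw [Finset.mul_sum]
  refine Fintype.sum_equiv (Equiv.mulRight τ) _ _ fun σ => ?_
  simp only [Equiv.coe_mulRight, Equiv.Perm.mul_apply, Equiv.Perm.sign_mul]
  rcases Int.units_eq_one_or (Equiv.Perm.sign τ) with h | h <;> simp [h]

lemma sgn_sq {p : ℕ} (τ : Equiv.Perm (Fin p)) :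
    ((Equiv.Perm.sign τ : ℤ) : ℝ) * ((Equiv.Perm.sign τ : ℤ) : ℝ) = 1 := by
  rcases Int.units_eq_one_or (Equiv.Perm.sign τ) with h | h <;> simp [h]

lemma wedge_Alt {ι : Type} {p q : ℕ} (S : PForm ι p) (T : PForm ι q) :
    (Alt S) ⋏ (Alt T) = Alt (tens S T) := by
  funext idx x
  have key : ∀ (τ : Equiv.Perm (Fin p)) (ρ : Equiv.Perm (Fin q)),
      ∑ σ : Equiv.Perm (Fin (p + q)), ((Equiv.Perm.sign σ : ℤ) : ℝ) *
        (((Equiv.Perm.sign τ : ℤ) : ℝ) * S (fun i => idx (σ (Fin.castAdd q (τ i)))) x *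
        (((Equiv.Perm.sign ρ : ℤ) : ℝ) * T (fun j => idx (σ (Fin.natAdd p (ρ j)))) x))
      = Alt (tens S T) idx x := by
    intro τ ρ
    have h := Alt_comp (tens S T) (finSumFinEquiv.permCongr (Equiv.Perm.sumCongr τ ρ)) idx x
    have hs : Equiv.Perm.sign (finSumFinEquiv.permCongr (Equiv.Perm.sumCongr τ ρ))
        = Equiv.Perm.sign τ * Equiv.Perm.sign ρ := by
      rw [Equiv.Perm.sign_permCongr, Equiv.Perm.sign_sumCongr]
    rw [hs] at h
    have h2 : Alt (tens S T) idx x = (((Equiv.Perm.sign τ : ℤ) : ℝ) * ((Equiv.Perm.sign ρ : ℤ) : ℝ)) *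
       ((((Equiv.Perm.sign τ * Equiv.Perm.sign ρ : ℤˣ) : ℤ) : ℝ) * Alt (tens S T) idx x) := by
      push_cast
      linear_combination (-(((Equiv.Perm.sign ρ : ℤ) : ℝ) * ((Equiv.Perm.sign ρ : ℤ) : ℝ)) * Alt (tens S T) idx x) * sgn_sq τ - Alt (tens S T) idx x * sgn_sq ρ
    rw [h2, ← h, Finset.mul_sum]
    refine Finset.sum_congr rfl fun σ _ => ?_
    simp only [tens, Equiv.permCongr_apply, finSumFinEquiv_symm_apply_castAdd,
      finSumFinEquiv_symm_apply_natAdd, Equiv.Perm.sumCongr_apply, Sum.map_inl, Sum.map_inr,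
      finSumFinEquiv_apply_left, finSumFinEquiv_apply_right]
    ring
  have e : (Alt S ⋏ Alt T) idx x = ((p.factorial * q.factorial : ℕ) : ℝ)⁻¹ *
      ∑ τ : Equiv.Perm (Fin p), ∑ ρ : Equiv.Perm (Fin q), Alt (tens S T) idx x := by
    simp only [wedge]
    congr 1
    rw [Finset.sum_congr rfl fun τ _ => Finset.sum_congr rfl fun ρ _ => (key τ ρ).symm]
    unfold Alt
    simp_rw [Finset.sum_mul_sum, Finset.mul_sum]
    rw [Finset.sum_comm]
    refine Finset.sum_congr rfl fun τ _ => ?_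
    rw [Finset.sum_comm]
  rw [e]
  simp only [Finset.sum_const, Finset.card_univ, Fintype.card_perm, Fintype.card_fin, nsmul_eq_mul]
  have hp : (p.factorial : ℝ) ≠ 0 := by exact_mod_cast p.factorial_ne_zero
  have hq : (q.factorial : ℝ) ≠ 0 := by exact_mod_cast q.factorial_ne_zero
  push_cast
  field_simp

lemma Alt_one {ι : Type} (α : PForm ι 1) : Alt α = α := by
  funext idx x
  simp [Alt]

lemma cast_Alt {ι : Type} {p q : ℕ} (h : p = q) (S : PForm ι p) :
    PForm.cast h (Alt S) = Alt (PForm.cast h S) := by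
  subst h
  rfl

/-- permutation from head index and tail permutation -/
def consPerm {p : ℕ} (k : Fin (p + 1)) (τ : Equiv.Perm (Fin p)) : Equiv.Perm (Fin (p + 1)) :=
  k.cycleRange.symm * Equiv.Perm.decomposeFin.symm (0, τ)

lemma consPerm_zero {p : ℕ} (k : Fin (p + 1)) (τ : Equiv.Perm (Fin p)) : consPerm k τ 0 = k := by
  simp [consPerm]

lemma consPerm_succ {p : ℕ} (k : Fin (p + 1)) (τ : Equiv.Perm (Fin p)) (i : Fin p) :
    consPerm k τ i.succ = k.succAbove (τ i) := by
  simp [consPerm]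

lemma consPerm_sign {p : ℕ} (k : Fin (p + 1)) (τ : Equiv.Perm (Fin p)) :
    ((Equiv.Perm.sign (consPerm k τ) : ℤ) : ℝ) = (-1) ^ (k : ℕ) * ((Equiv.Perm.sign τ : ℤ) : ℝ) := by
  simp [consPerm, Fin.sign_cycleRange, Equiv.Perm.sign_symm]

lemma consPerm_bij {p : ℕ} : Function.Bijective
    (fun kt : Fin (p + 1) × Equiv.Perm (Fin p) => consPerm kt.1 kt.2) := by
  rw [Fintype.bijective_iff_injective_and_card]
  constructor
  · rintro ⟨k, τ⟩ ⟨k', τ'⟩ h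
    simp only at h
    have h0 : k = k' := by
      have := congrArg (fun f => f 0) h
      simpa [consPerm_zero] using this
    subst h0
    congr 1
    ext i
    have := congrArg (fun f => f i.succ) h
    simp only [consPerm_succ] at this
    rw [Fin.succAbove_right_injective this]
  · simp [Fintype.card_perm, Nat.factorial_succ]

lemma extd_Alt {ι : Type} [Fintype ι] [DecidableEq ι] {p : ℕ} (S : PForm ι p)
    (hS : ∀ idx, Differentiable ℝ (S idx)) : extd (Alt S) = Alt (Dt S) := by
  funext idx x
  have e : ∀ (u : ι) (idx : Fin p → ι), pd u (Alt S idx) x =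
      ∑ σ : Equiv.Perm (Fin p), ((Equiv.Perm.sign σ : ℤ) : ℝ) * pd u (S (fun i => idx (σ i))) x := by
    intro u idx
    have : Alt S idx = fun x => ∑ σ : Equiv.Perm (Fin p), ((Equiv.Perm.sign σ : ℤ) : ℝ) * S (fun i => idx (σ i)) x := rfl
    rw [this]
    unfold pd
    rw [fderiv_fun_sum (fun σ _ => ((hS _).const_mul _).differentiableAt)]
    simp only [FunLike.coe_sum, Finset.sum_apply]
    refine Finset.sum_congr rfl fun σ _ => ?_
    rw [fderiv_const_mul (hS _).differentiableAt]
    rfl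
  unfold extd
  simp_rw [e]
  conv_rhs => unfold Alt
  rw [← consPerm_bij.sum_comp, Fintype.sum_prod_type]
  refine Finset.sum_congr rfl fun k _ => ?_
  rw [Finset.mul_sum]
  refine Finset.sum_congr rfl fun τ _ => ?_
  simp only [consPerm_sign, Dt, consPerm_zero, consPerm_succ, Function.comp]
  ring

lemma Alt_congr {ι : Type} {p : ℕ} (T T' : PForm ι (p + 2))
    (h : ∀ idx x, T idx x - T' idx x =
      T (fun i => idx (Equiv.swap 0 1 i)) x - T' (fun i => idx (Equiv.swap 0 1 i)) x) :
    Alt T = Alt T' := by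
  funext idx x
  have h1 := Alt_comp T (Equiv.swap 0 1) idx x
  have h2 := Alt_comp T' (Equiv.swap 0 1) idx x
  have h3 : ∑ σ : Equiv.Perm (Fin (p + 2)), ((Equiv.Perm.sign σ : ℤ) : ℝ) * T (fun i => idx (σ ((Equiv.swap 0 1) i))) x
     - ∑ σ : Equiv.Perm (Fin (p + 2)), ((Equiv.Perm.sign σ : ℤ) : ℝ) * T' (fun i => idx (σ ((Equiv.swap 0 1) i))) x
     = Alt T idx x - Alt T' idx x := by
    unfold Alt
    rw [← Finset.sum_sub_distrib, ← Finset.sum_sub_distrib]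
    refine Finset.sum_congr rfl fun σ _ => ?_
    rw [← mul_sub, ← mul_sub, h (fun i => idx (σ i)) x]
  rw [h1, h2, Equiv.Perm.sign_swap (by simp)] at h3
  push_cast at h3
  linarith

lemma det_eps {n : ℕ} (M : Matrix (Fin n) (Fin n) ℝ) (f : Fin n → Fin n) :
    (M.submatrix id f).det = eps f * M.det := by
  unfold eps
  split_ifs with h
  · exact Matrix.det_permute' (Equiv.ofBijective f h) M
  · rw [zero_mul]
    have : ¬ Function.Injective f := fun hi => h (Finite.injective_iff_bijective.1 hi)
    simp only [Function.Injective, not_forall] at this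
    obtain ⟨i, j, hij, hne⟩ := this
    refine Matrix.det_zero_of_column_eq hne fun k => ?_
    simp [hij]

lemma gam_eq (a b c : Fin 3) : gam a b c =
    ((1 : Matrix (Fin 3) (Fin 3) ℝ).submatrix id ![a, b, c]).det := by
  rw [det_eps]; simp [gam]

end EDS
namespace EDS

def dxc (n : ℕ) (i : Fin n) (u : YC n) : ℝ := if u = Sum.inr (Sum.inr i) then 1 else 0

lemma dx_apply (n : ℕ) (i : Fin n) (idx : Fin 1 → YC n) (x : Pt (YC n)) :
    dx n i idx x = dxc n i (idx 0) := by
  have h : xc n i = fun m => (ContinuousLinearMap.proj (R := ℝ) (φ := fun _ : YC n => ℝ)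
    (Sum.inr (Sum.inr i))) m := rfl
  simp only [dx, extd, ofFun, pd, h, ContinuousLinearMap.fderiv]
  rw [Fin.sum_univ_one]
  simp [dxc, Pi.single_apply, eq_comm]

lemma Fc_smooth (n : ℕ) (a : Fin 3) (i j : Fin n) : ContDiff ℝ 2 (Fc n a i j) := by
  unfold Fc
  split_ifs
  · exact contDiff_apply _ _ _
  · exact (contDiff_apply _ _ _).neg
  · exact contDiff_const

lemma Fc_anti (n : ℕ) (a : Fin 3) (i : Fin n) (x : Pt (YC n)) : Fc n a i i x = 0 := by
  simp [Fc]

def Af (n : ℕ) (b : Fin 3) (u : YC n) (x : Pt (YC n)) : ℝ := ∑ i, Ac n b i x * dxc n i u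

lemma Aform_apply (n : ℕ) (b : Fin 3) (idx : Fin 1 → YC n) (x : Pt (YC n)) :
    Aform n b idx x = Af n b (idx 0) x := by
  simp [Aform, Af, Finset.sum_apply, fsmul, dx_apply]

lemma Af_smooth (n : ℕ) (b : Fin 3) (u : YC n) : ContDiff ℝ 2 (Af n b u) := by
  unfold Af Ac
  refine ContDiff.sum fun i _ => ContDiff.mul (contDiff_apply _ _ _) contDiff_const

def cf {n : ℕ} (i j : Fin n) (k : Fin (n - 2) → Fin n) : ℝ :=
  etaD i * etaD j * (∏ t, etaD (k t)) * eps (raiseIdx i j k)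

def Sten (n : ℕ) (c : Fin 3) : PForm (YC n) (n - 2) := fun r x =>
  ((2 * (n - 2).factorial : ℕ) : ℝ)⁻¹ * ∑ i, ∑ j, ∑ k : Fin (n - 2) → Fin n,
    cf i j k * (Fc n c i j x * ∏ t, dxc n (k t) (r t))

lemma Sten_smooth (n : ℕ) (c : Fin 3) (r : Fin (n - 2) → YC n) : ContDiff ℝ 2 (Sten n c r) := by
  unfold Sten
  refine ContDiff.mul contDiff_const (ContDiff.sum fun i _ => ContDiff.sum fun j _ =>
    ContDiff.sum fun k _ => ContDiff.mul contDiff_const (ContDiff.mul (Fc_smooth _ _ _ _) contDiff_const))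

lemma starF_eq (n : ℕ) (c : Fin 3) : starF n c = Alt (Sten n c) := by
  funext r x
  simp only [starF, Alt, Sten, Pi.smul_apply, Finset.sum_apply, smul_eq_mul, fsmul, wedgeFam, dx_apply]
  have : ∀ σ : Equiv.Perm (Fin (n-2)), ((Equiv.Perm.sign σ : ℤ) : ℝ) *
      (((2 * (n - 2).factorial : ℕ) : ℝ)⁻¹ * ∑ i, ∑ j, ∑ k : Fin (n - 2) → Fin n,
    cf i j k * (Fc n c i j x * ∏ t, dxc n (k t) (r (σ t)))) =
     ((2 * (n - 2).factorial : ℕ) : ℝ)⁻¹ * ∑ i, ∑ j, ∑ k : Fin (n - 2) → Fin n,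
    cf i j k * (Fc n c i j x * (((Equiv.Perm.sign σ : ℤ) : ℝ) * ∏ t, dxc n (k t) (r (σ t)))) := by
    intro σ
    simp only [Finset.mul_sum]
    refine Finset.sum_congr rfl fun i _ => Finset.sum_congr rfl fun j _ => Finset.sum_congr rfl fun k _ => ?_
    ring
  rw [Finset.sum_congr rfl fun σ _ => this σ, ← Finset.mul_sum]
  congr 1
  symm
  rw [Finset.sum_comm]
  refine Finset.sum_congr rfl fun i _ => ?_
  rw [Finset.sum_comm]
  refine Finset.sum_congr rfl fun j _ => ?_
  rw [Finset.sum_comm]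
  refine Finset.sum_congr rfl fun k _ => ?_
  rw [← Finset.mul_sum, ← Finset.mul_sum]
  rfl

lemma Alt_lin1 {ι : Type} {p : ℕ} (g : Fin 3 → Fin 3 → ℝ) (r : ℝ) (T : Fin 3 → Fin 3 → PForm ι p) :
    r • ∑ b, ∑ c, g b c • Alt (T b c) = Alt (r • ∑ b, ∑ c, g b c • T b c) := by
  funext idx x
  simp only [Alt, Pi.smul_apply, Finset.sum_apply, smul_eq_mul, Finset.mul_sum]
  conv_rhs => rw [Finset.sum_comm]
  refine Finset.sum_congr rfl fun b _ => ?_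
  conv_rhs => rw [Finset.sum_comm]
  refine Finset.sum_congr rfl fun c _ => ?_
  refine Finset.sum_congr rfl fun σ _ => ?_
  ring

lemma Alt_add {ι : Type} {p : ℕ} (S T : PForm ι p) : Alt (S + T) = Alt S + Alt T := by
  funext idx x
  simp [Alt, mul_add, Finset.sum_add_distrib]

lemma Alt_neg {ι : Type} {p : ℕ} (S : PForm ι p) : Alt (-S) = -Alt S := by
  funext idx x
  simp [Alt]

lemma Alt_sub {ι : Type} {p : ℕ} (S T : PForm ι p) : Alt (S - T) = Alt S - Alt T := by
  rw [sub_eq_add_neg, Alt_add, Alt_neg, sub_eq_add_neg]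

def t1 {n p : ℕ} (b : Fin 3) (S : PForm (YC n) p) : PForm (YC n) (p + 1) := fun idx x =>
  Af n b (idx 0) x * S (fun i => idx i.succ) x

lemma cast_wedge_A {n p : ℕ} (h : 1 + p = p + 1) (b : Fin 3) (S : PForm (YC n) p) :
    PForm.cast h (Aform n b ⋏ Alt S) = Alt (t1 b S) := by
  conv_lhs => rw [← Alt_one (Aform n b)]
  rw [wedge_Alt, cast_Alt]
  congr 1
  funext idx x
  simp only [PForm.cast, tens, t1, Aform_apply]
  congr 3
  funext i
  congr 1
  ext
  simp

def t2 {n p : ℕ} (B : PForm (YC n) 2) (S : PForm (YC n) p) : PForm (YC n) (p + 1 + 1) := fun idx x =>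
  B (fun i => idx (if i = 0 then 0 else 1)) x * S (fun i => idx i.succ.succ) x

lemma cast_wedge_2 {n p : ℕ} (h : 2 + p = p + 1 + 1) (B : PForm (YC n) 2) (S : PForm (YC n) p) :
    PForm.cast h (Alt B ⋏ Alt S) = Alt (t2 B S) := by
  rw [wedge_Alt, cast_Alt]
  congr 1
  funext idx x
  simp only [PForm.cast, tens, t2]
  congr 2
  · congr 1
    funext i
    congr 1
    fin_cases i <;> rfl
  · congr 1
    funext i
    congr 1
    ext
    simp

lemma cast_lin {ι : Type} {p q : ℕ} (h : p = q) (g : Fin 3 → Fin 3 → ℝ) (r : ℝ) (T : Fin 3 → Fin 3 → PForm ι p) :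
    PForm.cast h (r • ∑ b, ∑ c, g b c • T b c) = r • ∑ b, ∑ c, g b c • PForm.cast h (T b c) := by
  subst h
  rfl

def Pten (n : ℕ) (a : Fin 3) : PForm (YC n) (n - 2 + 1) :=
  -Dt (Sten n a) - (1/4 : ℝ) • ∑ b, ∑ c, gam c a b • t1 b (Sten n c)

lemma psi_eq (n : ℕ) (a : Fin 3) : psi n a = Alt (Pten n a) := by
  unfold psi Pten
  rw [Alt_sub, Alt_neg, cast_lin, ← Alt_lin1, ← extd_Alt _ (fun r => (Sten_smooth n a r).differentiable (by norm_num))]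
  simp only [starF_eq, cast_wedge_A]

def Thten (n : ℕ) (a : Fin 3) : PForm (YC n) 2 := fun idx x =>
  pd (idx 0) (Af n a (idx 1)) x + (1/8 : ℝ) * ∑ b, ∑ c, gam a b c * (Af n b (idx 0) x * Af n c (idx 1) x)

def Ften (n : ℕ) (a : Fin 3) : PForm (YC n) 2 := fun idx x =>
  (1/2 : ℝ) * ∑ i, ∑ j, Fc n a i j x * (dxc n i (idx 0) * dxc n j (idx 1))

lemma Fform_eq (n : ℕ) (a : Fin 3) : Fform n a = Alt (Ften n a) := by
  have h : ∀ i j, dx n i ⋏ dx n j = Alt (tens (dx n i) (dx n j)) := by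
    intro i j
    rw [← wedge_Alt, Alt_one, Alt_one]
  funext idx x
  simp only [Fform, h, Alt, tens, Ften, Pi.smul_apply, Finset.sum_apply, smul_eq_mul, fsmul, Finset.mul_sum]
  conv_rhs => rw [Finset.sum_comm]
  refine Finset.sum_congr rfl fun i _ => ?_
  conv_rhs => rw [Finset.sum_comm]
  refine Finset.sum_congr rfl fun j _ => Finset.sum_congr rfl fun σ _ => ?_
  simp only [dx_apply]
  have e1 : Fin.castAdd 1 (0 : Fin 1) = (0 : Fin 2) := rfl
  have e2 : Fin.natAdd 1 (0 : Fin 1) = (1 : Fin 2) := rfl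
  rw [e1, e2]
  ring

lemma theta_eq (n : ℕ) (a : Fin 3) : theta n a = Alt (Thten n a - Ften n a) := by
  have h : ∀ b c, Aform n b ⋏ Aform n c = Alt (tens (Aform n b) (Aform n c)) := by
    intro i j
    rw [← wedge_Alt, Alt_one, Alt_one]
  have h1 : extd (Aform n a) = Alt (Dt (Aform n a)) := by
    conv_lhs => rw [← Alt_one (Aform n a)]
    rw [extd_Alt]
    intro idx
    have : Aform n a idx = Af n a (idx 0) := by funext x; exact Aform_apply _ _ _ _
    rw [this]
    exact (Af_smooth n a _).differentiable (by norm_num)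
  have h2 : Thten n a = Dt (Aform n a) + (1/8 : ℝ) • ∑ b, ∑ c, gam a b c • (tens (Aform n b) (Aform n c) : PForm (YC n) 2) := by
    funext idx x
    have : ∀ idx, Aform n a idx = Af n a (idx 0) := by intro idx; funext x; exact Aform_apply _ _ _ _
    simp only [Thten, Dt, this, tens, Pi.add_apply, Pi.smul_apply, Finset.sum_apply, smul_eq_mul, Aform_apply]
    rfl
  unfold theta
  rw [Alt_sub, h2, Alt_add, ← Alt_lin1, h1, Fform_eq]
  simp only [h]
  abel

end EDS
namespace EDS

lemma cf_eq (m : ℕ) (i j : Fin (m + 2)) (k : Fin m → Fin (m + 2)) :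
    cf (n := m + 2) i j k = (∏ t : Fin (m + 2), etaD t) * eps (raiseIdx (n := m + 2) i j k) := by
  have h : etaD i * etaD j * (∏ t, etaD (k t)) = ∏ t, etaD (raiseIdx (n := m + 2) i j k t) := by
    rw [Fin.prod_univ_succ, Fin.prod_univ_succ, ← mul_assoc]
    rfl
  change etaD i * etaD j * (∏ t, etaD (k t)) * eps (raiseIdx (n := m + 2) i j k) = _
  rw [h]
  unfold eps
  split_ifs with hb
  · congr 1
    exact (Equiv.ofBijective _ hb).prod_comp (fun t => etaD t)
  · simp

lemma t2_eq (m : ℕ) (b c : Fin 3) (idx : Fin (m + 2) → YC (m + 2)) (x : Pt (YC (m + 2))) :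
    t2 (n := m + 2) (p := m) (Ften (m + 2) b) (Sten (m + 2) c) idx x =
      ∑ i, ∑ j, ∑ l, ∑ r, ∑ k : Fin m → Fin (m + 2),
        ((1/2 : ℝ) * ((2 * m.factorial : ℕ) : ℝ)⁻¹ * (∏ t : Fin (m + 2), etaD t)
          * (Fc (m + 2) b i j x * Fc (m + 2) c l r x * eps (raiseIdx (n := m + 2) l r k)))
          * ∏ t, dxc (m + 2) (raiseIdx (n := m + 2) i j k t) (idx t) := by
  have h : t2 (n := m + 2) (p := m) (Ften (m + 2) b) (Sten (m + 2) c) idx x =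
      ((1/2 : ℝ) * ∑ i, ∑ j, Fc (m + 2) b i j x * (dxc (m + 2) i (idx 0) * dxc (m + 2) j (idx 1))) *
      (((2 * m.factorial : ℕ) : ℝ)⁻¹ * ∑ i, ∑ j, ∑ k : Fin m → Fin (m + 2),
        cf (n := m + 2) i j k * (Fc (m + 2) c i j x * ∏ t : Fin m, dxc (m + 2) (k t) (idx t.succ.succ))) := rfl
  rw [h]
  rw [Finset.mul_sum, Finset.sum_mul]
  refine Finset.sum_congr rfl fun i _ => ?_
  rw [Finset.mul_sum, Finset.sum_mul]
  refine Finset.sum_congr rfl fun j _ => ?_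
  simp only [Finset.mul_sum]
  refine Finset.sum_congr rfl fun l _ => Finset.sum_congr rfl fun r _ => Finset.sum_congr rfl fun k _ => ?_
  rw [cf_eq]
  have h2 : ∏ t, dxc (m + 2) (raiseIdx (n := m + 2) i j k t) (idx t) =
      dxc (m + 2) i (idx 0) * (dxc (m + 2) j (idx 1) * ∏ t : Fin m, dxc (m + 2) (k t) (idx t.succ.succ)) := by
    rw [Fin.prod_univ_succ, Fin.prod_univ_succ]
    rfl
  rw [h2]
  ring

lemma Alt_dx {n : ℕ} (f : Fin n → Fin n) (idx : Fin n → YC n) :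
    ∑ σ : Equiv.Perm (Fin n), ((Equiv.Perm.sign σ : ℤ) : ℝ) * ∏ t, dxc n (f t) (idx (σ t)) =
      eps f * (Matrix.of fun s t => dxc n t (idx s)).det := by
  rw [← det_eps, Matrix.det_apply']
  rfl

lemma FS_eq (m : ℕ) (b c : Fin 3) (idx : Fin (m + 2) → YC (m + 2)) (x : Pt (YC (m + 2))) :
    Alt (t2 (n := m + 2) (p := m) (Ften (m + 2) b) (Sten (m + 2) c)) idx x =
      ∑ i, ∑ j, ∑ l, ∑ r, ∑ k : Fin m → Fin (m + 2),
        ((1/2 : ℝ) * ((2 * m.factorial : ℕ) : ℝ)⁻¹ * (∏ t : Fin (m + 2), etaD t)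
          * (Fc (m + 2) b i j x * Fc (m + 2) c l r x * eps (raiseIdx (n := m + 2) l r k)))
          * (eps (raiseIdx (n := m + 2) i j k) *
            (Matrix.of fun s t => dxc (m + 2) t (idx s)).det) := by
  unfold Alt
  simp only [t2_eq]
  simp only [Finset.mul_sum]
  rw [Finset.sum_comm]
  refine Finset.sum_congr rfl fun i _ => ?_
  rw [Finset.sum_comm]
  refine Finset.sum_congr rfl fun j _ => ?_
  rw [Finset.sum_comm]
  refine Finset.sum_congr rfl fun l _ => ?_
  rw [Finset.sum_comm]
  refine Finset.sum_congr rfl fun r _ => ?_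
  rw [Finset.sum_comm]
  refine Finset.sum_congr rfl fun k _ => ?_
  rw [← Alt_dx, Finset.mul_sum]
  refine Finset.sum_congr rfl fun σ _ => ?_
  ring

lemma FS_symm (m : ℕ) (b c : Fin 3) :
    Alt (t2 (n := m + 2) (p := m) (Ften (m + 2) b) (Sten (m + 2) c)) =
    Alt (t2 (n := m + 2) (p := m) (Ften (m + 2) c) (Sten (m + 2) b)) := by
  funext idx x
  rw [FS_eq, FS_eq]
  simp only [← Fintype.sum_prod_type']
  refine Fintype.sum_equiv ⟨fun p => (p.2.2.1, p.2.2.2.1, p.1, p.2.1, p.2.2.2.2),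
    fun p => (p.2.2.1, p.2.2.2.1, p.1, p.2.1, p.2.2.2.2), fun _ => rfl, fun _ => rfl⟩ _ _ ?_
  rintro ⟨i, j, l, r, k⟩
  simp only [Equiv.coe_fn_mk]
  ring

lemma gam_FS (n : ℕ) (hn : 3 ≤ n) (a : Fin 3) :
    ∑ b, ∑ c, gam c a b • Alt (t2 (Ften n b) (Sten n c)) = 0 := by
  obtain ⟨m, rfl⟩ : ∃ m, n = m + 2 := ⟨n - 2, by omega⟩
  have hs : ∀ b c, Alt (t2 (Ften (m + 2) b) (Sten (m + 2) c)) = Alt (t2 (Ften (m + 2) c) (Sten (m + 2) b)) :=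
    FS_symm m
  have hg : ∀ b c, gam b a c = - gam c a b := by
    intro b c
    fin_cases a <;> fin_cases b <;> fin_cases c <;> simp [gam_eq, Matrix.det_fin_three, Matrix.one_apply]
  have h : ∑ b, ∑ c, gam c a b • Alt (t2 (Ften (m + 2) b) (Sten (m + 2) c)) =
      - ∑ b, ∑ c, gam c a b • Alt (t2 (Ften (m + 2) b) (Sten (m + 2) c)) := by
    conv_lhs => rw [Finset.sum_comm]
    simp only [← Finset.sum_neg_distrib]
    refine Finset.sum_congr rfl fun b _ => Finset.sum_congr rfl fun c _ => ?_
    rw [hg, hs, neg_smul]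
  funext idx x
  have := congrFun (congrFun h idx) x
  simp only [Pi.neg_apply] at this
  simp only [Pi.zero_apply]
  linarith

lemma pd_symm {ι : Type} [Fintype ι] [DecidableEq ι] (f : Pt ι → ℝ) (hf : ContDiff ℝ 2 f) (u v : ι) (x : Pt ι) :
    pd u (fun y => pd v f y) x = pd v (fun y => pd u f y) x := by
  have hd : Differentiable ℝ (fderiv ℝ f) := (hf.fderiv_right (m := 1) (by norm_num)).differentiable (by norm_num)
  have e : ∀ u v, pd u (fun y => pd v f y) x = fderiv ℝ (fderiv ℝ f) x (Pi.single u 1) (Pi.single v 1) := by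
    intro u v
    unfold pd
    rw [fderiv_clm_apply hd.differentiableAt (differentiableAt_const _)]
    simp
  rw [e, e]
  exact (hf.contDiffAt.isSymmSndFDerivAt (by simp)) _ _

lemma pd_diff {ι : Type} [Fintype ι] [DecidableEq ι] (f : Pt ι → ℝ) (hf : ContDiff ℝ 2 f) (v : ι) :
    Differentiable ℝ (fun y => pd v f y) := by
  have hd : Differentiable ℝ (fderiv ℝ f) := (hf.fderiv_right (m := 1) (by norm_num)).differentiable (by norm_num)
  unfold pd
  exact hd.clm_apply (differentiable_const _)

lemma Pten_apply (n : ℕ) (a : Fin 3) (idx : Fin (n - 2 + 1) → YC n) :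
    Pten n a idx = fun x => -pd (idx 0) (Sten n a (fun i => idx i.succ)) x - (1/4 : ℝ) * ∑ b, ∑ c,
      gam c a b * (Af n b (idx 0) x * Sten n c (fun i => idx i.succ) x) := by
  funext x
  simp [Pten, Dt, t1, Finset.sum_apply]

lemma Pten_diff (n : ℕ) (a : Fin 3) (idx : Fin (n - 2 + 1) → YC n) : Differentiable ℝ (Pten n a idx) := by
  rw [Pten_apply]
  have h1 := pd_diff _ (Sten_smooth n a (fun i => idx i.succ)) (idx 0)
  have h2 := fun c => (Sten_smooth n c (fun i => idx i.succ)).differentiable (by norm_num)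
  have h3 := fun b => (Af_smooth n b (idx 0)).differentiable (by norm_num)
  fun_prop

lemma pd_Pten (n : ℕ) (a : Fin 3) (u v : YC n) (r : Fin (n - 2) → YC n) (x : Pt (YC n)) :
    pd u (fun x => -pd v (Sten n a r) x - (1/4 : ℝ) * ∑ b, ∑ c,
      gam c a b * (Af n b v x * Sten n c r x)) x =
    -pd u (fun y => pd v (Sten n a r) y) x - (1/4 : ℝ) * ∑ b, ∑ c,
      gam c a b * (pd u (Af n b v) x * Sten n c r x + Af n b v x * pd u (Sten n c r) x) := by
  have h1 := pd_diff _ (Sten_smooth n a r) v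
  have h2 := fun c => (Sten_smooth n c r).differentiable (by norm_num)
  have h3 := fun b => (Af_smooth n b v).differentiable (by norm_num)
  have k1 := (h1 x).hasFDerivAt
  have k2 := fun c => (h2 c x).hasFDerivAt
  have k3 := fun b => (h3 b x).hasFDerivAt
  have k := k1.fun_neg.fun_sub ((HasFDerivAt.fun_sum (u := Finset.univ) fun b _ =>
    HasFDerivAt.fun_sum (u := Finset.univ) fun c _ =>
      ((k3 b).fun_mul (k2 c)).const_mul (gam c a b)).const_mul (1/4 : ℝ))
  conv_lhs => unfold pd
  rw [show (fun x => -fderiv ℝ (Sten n a r) x (Pi.single v 1) - (1/4 : ℝ) * ∑ b, ∑ c,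
      gam c a b * (Af n b v x * Sten n c r x)) = _ from rfl]
  erw [k.fderiv]
  simp only [pd, _root_.sub_apply, _root_.neg_apply, _root_.smul_apply,
    _root_.add_apply, smul_eq_mul, FunLike.coe_sum, Finset.sum_apply]
  congr 2
  refine Finset.sum_congr rfl fun b _ => Finset.sum_congr rfl fun c _ => ?_
  ring

lemma main_tensor (n : ℕ) (a : Fin 3) :
    Alt (Dt (Pten n a)) = Alt (-((1/4 : ℝ) • ∑ b, ∑ c, gam c a b • t1 b (Pten n c)) -
      (1/4 : ℝ) • ∑ b, ∑ c, gam c a b • t2 (Thten n b) (Sten n c)) := by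
  apply Alt_congr
  intro idx x
  have e0 : (Equiv.swap (0 : Fin (n - 2 + 2)) 1) 0 = 1 := by simp
  have e1 : (Equiv.swap (0 : Fin (n - 2 + 2)) 1) 1 = 0 := by simp
  have es : ∀ i : Fin (n - 2), (Equiv.swap (0 : Fin (n - 2 + 2)) 1) i.succ.succ = i.succ.succ := by
    intro i
    apply Equiv.swap_apply_of_ne_of_ne
    · exact Fin.succ_ne_zero _
    · intro h
      exact Fin.succ_ne_zero i (Fin.succ_injective _ h)
  have s0 : Fin.succ (0 : Fin (n - 2 + 1)) = 1 := rfl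
  simp only [Dt, Pten_apply, pd_Pten, t1, t2, Thten, Pi.sub_apply, Pi.neg_apply, Pi.smul_apply,
    Finset.sum_apply, smul_eq_mul, s0, e0, e1, es, if_true, Fin.isValue, one_ne_zero, if_false]
  have hd := pd_symm _ (Sten_smooth n a (fun i => idx i.succ.succ)) (idx 0) (idx 1) x
  simp only [Fin.sum_univ_three]
  generalize pd (idx 0) (fun y => pd (idx 1) (Sten n a (fun i => idx i.succ.succ)) y) x = q1 at *
  generalize pd (idx 1) (fun y => pd (idx 0) (Sten n a (fun i => idx i.succ.succ)) y) x = q2 at *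
  subst hd
  fin_cases a <;> simp [gam_eq, Matrix.det_fin_three, Matrix.one_apply] <;> ring

end EDS
open EDS

theorem stmt11 (n : ℕ) (hn : 3 ≤ n) (a : Fin 3) :
    extd (psi n a) =
      -(PForm.cast (show 1 + (n - 2 + 1) = n - 2 + 1 + 1 by omega)
          ((1/4 : ℝ) • ∑ b, ∑ c, gam c a b • (Aform n b ⋏ psi n c))) -
        PForm.cast (show 2 + (n - 2) = n - 2 + 1 + 1 by omega)
          ((1/4 : ℝ) • ∑ b, ∑ c, gam c a b • (theta n b ⋏ starF n c)) := by
  simp only [theta_eq, psi_eq, starF_eq]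
  rw [extd_Alt _ (Pten_diff n a), cast_lin, cast_lin]
  simp only [cast_wedge_A, cast_wedge_2]
  have h : ∀ b c, Alt (t2 (Thten n b - Ften n b) (Sten n c)) =
      Alt (t2 (Thten n b) (Sten n c)) - Alt (t2 (Ften n b) (Sten n c)) := by
    intro b c
    rw [← Alt_sub]
    congr 1
    funext idx x
    simp [t2, sub_mul]
  simp only [h, smul_sub, Finset.sum_sub_distrib, gam_FS n hn a, smul_zero, sub_zero]
  rw [main_tensor, Alt_sub, Alt_neg, ← Alt_lin1, ← Alt_lin1]
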